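/- Suppose p = 2, char F ≠ 2, n = 1, and -1 ∉ N_{K/F}(K^×). Let ν ∈ {1,2,3,…} ∪ {∞} be such that K contains a primitive 2^ν-th root of unity but no primitive 2^{ν+1}-st root of unity (ν = ∞ if K contains primitive 2^k-th roots of unity for all k). Then for every m ≥ 1: if ν < ∞, then J_m ≅ Z ⊕ Y_0 ⊕ Y_1 as R_m[G]-modules, where Z ≅ R_m[G]/⟨2^ν(σ-1)⟩ is indecomposable, Y_0 is a free R_m-module with trivial G-action whose rank e(0) satisfies e(0) + 1 = e_0(K/F), and Y_1 is a free R_m[G]-module whose rank e(1) satisfies e(1) + 1 = e_1(K/F); if ν = ∞, then J_m ≅ Y_0 ⊕ Y_1, where Y_0 is a free R_m-module with trivial G-action whose rank e(0) satisfies e(0) + 1 = e_0(K/F) and Y_1 is a free R_m[G]-module of rank e_1(K/F). -/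

import Mathlib

/-!
Common setup.  Throughout, `K/F` is a cyclic Galois extension of degree `p^n`
with Galois group `G = Gal(K/F)` generated by `σ`.  For `0 ≤ i ≤ n`, `K_i`
denotes the intermediate field of degree `p^i` over `F`, realized here via its
unit group `KiU p σ i` (the units of `K` fixed by `σ^{p^i}`), and
`G_i = Gal(K_i/F)`.  For `m ≥ 1`, `R_m = ℤ/p^m` and `J_m = K^×/K^{×p^m}`.
-/

namespace MSS

variable {F K : Type*} [Field F] [Field K] [Algebra F K]

/-- Action of a field automorphism on the unit group. -/
def umap (σ : K ≃ₐ[F] K) : Kˣ →* Kˣ := Units.map (σ : K →* K)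

/-- The norm from `K_j` to `F`, computed in `K` as the product of conjugates
`∏_{k < p^j} σ^k(γ)` (valid for `γ ∈ K_j`). -/
noncomputable def normHom (p : ℕ) (σ : K ≃ₐ[F] K) (j : ℕ) : Kˣ →* Kˣ :=
  ∏ k ∈ Finset.range (p ^ j), umap (σ ^ k)

/-- The unit group of the intermediate field `K_i`: the units fixed by `σ^{p^i}`. -/
def KiU (p : ℕ) (σ : K ≃ₐ[F] K) (i : ℕ) : Subgroup Kˣ :=
  (umap (σ ^ p ^ i) / MonoidHom.id Kˣ).ker

/-- Membership in `K_a^×` for a level `a ∈ {-∞, 0, 1, …}`; level `-∞` means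
the trivial group `{1}`. -/
def levelMem (p : ℕ) (σ : K ≃ₐ[F] K) (a : WithBot ℕ) (γ : Kˣ) : Prop :=
  WithBot.recBotCoe (γ = 1) (fun i => γ ∈ KiU p σ i) a

/-- `(α, δ)` represents the pair `(a, d)`:  `σ(α)·α^{-d} = ∏_{i=0}^m δ_i^{p^i}` with
`δ_i ∈ K_{a_i}^×` for `i < m`, and
`ξ_p = N_{K/F}(α)^{(d-1)/p} · N_{K_{n-1}/F}(δ_0) · ∏_{i=1}^m N_{K/F}(δ_i)^{p^{i-1}}`. -/
noncomputable def Represents (p n : ℕ) (σ : K ≃ₐ[F] K) (ξ : Kˣ) {m : ℕ}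
    (a : Fin m → WithBot ℕ) (d : ℤ) (α : Kˣ) (δ : ℕ → Kˣ) : Prop :=
  (∀ i : Fin m, levelMem p σ (a i) (δ i)) ∧
  umap σ α = α ^ d * ∏ i ∈ Finset.range (m + 1), δ i ^ p ^ i ∧
  ξ = normHom p σ n α ^ ((d - 1) / (p : ℤ)) * normHom p σ (n - 1) (δ 0) *
      ∏ i ∈ Finset.Icc 1 m, normHom p σ n (δ i) ^ p ^ (i - 1)

/-- `(a, d)` is a norm pair of length `m`: `a ∈ {-∞,0,…,n}^m` with `a_0 < n`,
`d ∈ U_1`, and some `(α, δ)` represents `(a, d)`. -/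
noncomputable def IsNormPair (p n : ℕ) (σ : K ≃ₐ[F] K) (ξ : Kˣ) {m : ℕ}
    (a : Fin m → WithBot ℕ) (d : ℤ) : Prop :=
  (∀ i, a i ≤ (n : WithBot ℕ)) ∧
  (∀ h0 : 0 < m, a ⟨0, h0⟩ < (n : WithBot ℕ)) ∧
  (p : ℤ) ∣ d - 1 ∧
  ∃ (α : Kˣ) (δ : ℕ → Kˣ), Represents p n σ ξ a d α δ

/-- Strict lexicographic order on norm vectors (with `-∞` smallest). -/
def vecLT {m : ℕ} (a a' : Fin m → WithBot ℕ) : Prop :=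
  ∃ k : Fin m, (∀ j : Fin m, j < k → a j = a' j) ∧ a k < a' k

/-- The order `d ≤_m d'` on twists: `d' ∈ U_i → d ∈ U_i` for `1 ≤ i ≤ m`, except
when `p = 2` and `d, d' ∉ U_2`, in which case `d' ∈ -U_i → d ∈ -U_i` for `2 ≤ i ≤ m`. -/
def twistLE (p m : ℕ) (d d' : ℤ) : Prop :=
  ((p = 2 ∧ ¬ (4 : ℤ) ∣ (d - 1) ∧ ¬ (4 : ℤ) ∣ (d' - 1)) →
    ∀ i : ℕ, 2 ≤ i → i ≤ m → ((2 : ℤ) ^ i ∣ (d' + 1)) → ((2 : ℤ) ^ i ∣ (d + 1))) ∧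
  (¬ (p = 2 ∧ ¬ (4 : ℤ) ∣ (d - 1) ∧ ¬ (4 : ℤ) ∣ (d' - 1)) →
    ∀ i : ℕ, 1 ≤ i → i ≤ m → ((p : ℤ) ^ i ∣ (d' - 1)) → ((p : ℤ) ^ i ∣ (d - 1)))

/-- The order `⪯_m` on norm pairs of length `m`. -/
def pairLE (p : ℕ) {m : ℕ} (a : Fin m → WithBot ℕ) (d : ℤ)
    (a' : Fin m → WithBot ℕ) (d' : ℤ) : Prop :=
  vecLT a a' ∨ (a = a' ∧ twistLE p m d d')

/-- `(a, d)` is a minimal norm pair of length `m`. -/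
noncomputable def IsMinimalNormPair (p n : ℕ) (σ : K ≃ₐ[F] K) (ξ : Kˣ) {m : ℕ}
    (a : Fin m → WithBot ℕ) (d : ℤ) : Prop :=
  IsNormPair p n σ ξ a d ∧
  ∀ (a' : Fin m → WithBot ℕ) (d' : ℤ), IsNormPair p n σ ξ a' d' → pairLE p a d a' d'

/-- `α` is an `m`-exceptional element. -/
noncomputable def IsExceptional (p n : ℕ) (σ : K ≃ₐ[F] K) (ξ : Kˣ) (m : ℕ) (α : Kˣ) : Prop :=
  ∃ (a : Fin m → WithBot ℕ) (d : ℤ) (δ : ℕ → Kˣ),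
    IsMinimalNormPair p n σ ξ a d ∧ Represents p n σ ξ a d α δ

/-- The subgroup of `q`-th powers in `K^×`. -/
def powSub (K : Type*) [Field K] (q : ℕ) : Subgroup Kˣ := (powMonoidHom q : Kˣ →* Kˣ).range

/-- The class of a unit in `J_q := K^×/K^{×q}`. -/
def jcls (q : ℕ) (γ : Kˣ) : Kˣ ⧸ powSub K q := QuotientGroup.mk γ

/-- The action of a field automorphism on `J_q = K^×/K^{×q}`. -/
noncomputable def jmap (q : ℕ) (τ : K ≃ₐ[F] K) : (Kˣ ⧸ powSub K q) →* Kˣ ⧸ powSub K q :=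
  QuotientGroup.map _ _ (umap τ) (by
    rintro x ⟨y, rfl⟩
    exact ⟨umap τ y, by simp [powMonoidHom, map_pow]⟩)

/-- The natural map `J_q → J_{q'}` when `q' ∣ q`. -/
noncomputable def resMap (q q' : ℕ) (h : q' ∣ q) : (Kˣ ⧸ powSub K q) →* Kˣ ⧸ powSub K q' :=
  QuotientGroup.map _ _ (MonoidHom.id Kˣ) (by
    rintro x ⟨y, rfl⟩
    obtain ⟨c, rfl⟩ := h
    exact ⟨y ^ c, by simp [powMonoidHom, ← pow_mul, mul_comm]⟩)

/-- The `R_m[G]`-submodule of `J_q` generated by the classes of the elements of `S`: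
the subgroup generated by all `σ^k`-conjugates of classes of elements of `S`. -/
noncomputable def galSpan (q : ℕ) (σ : K ≃ₐ[F] K) (S : Set Kˣ) : Subgroup (Kˣ ⧸ powSub K q) :=
  Subgroup.closure {x | ∃ γ ∈ S, ∃ k : ℕ, x = jcls q (umap (σ ^ k) γ)}

/-- The subgroup `(σ-1)J_q` of `J_q`. -/
noncomputable def augSub (q : ℕ) (σ : K ≃ₐ[F] K) : Subgroup (Kˣ ⧸ powSub K q) :=
  Subgroup.closure {x | ∃ y : Kˣ ⧸ powSub K q, x = jmap q σ y * y⁻¹}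

/-- The cyclic `F_p[G]`-submodule of `J_1 = K^×/K^{×p}` generated by `[γ]_1` is a
free `F_p[G_i]`-module (on the generator `[γ]_1`): `[γ]_1` is fixed by `σ^{p^i}`
and the conjugates `σ^k [γ]_1`, `k < p^i`, are `F_p`-linearly independent. -/
noncomputable def FreeCyc (p : ℕ) (σ : K ≃ₐ[F] K) (i : ℕ) (γ : Kˣ) : Prop :=
  jcls p (umap (σ ^ p ^ i) γ) = jcls p γ ∧
  ∀ c : Fin (p ^ i) → ZMod p,
    (∏ k : Fin (p ^ i), jcls p (umap (σ ^ (k : ℕ)) γ) ^ (c k).val) = 1 → c = 0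

/-- An (indexed) internal direct sum decomposition of a commutative group. -/
def IsDirectSumDecomp {G : Type*} [CommGroup G] {ι : Sort*} (f : ι → Subgroup G) : Prop :=
  iSupIndep f ∧ (⨆ i, f i) = ⊤

/-- The subgroup `F^×` of `K^×` (units coming from the base field). -/
def Funits (F : Type*) {K : Type*} [Field F] [Field K] [Algebra F K] : Subgroup Kˣ :=
  (Units.map (algebraMap F K : F →* K)).range

/-- The subgroup `F^{×p}` of `K^×`. -/
def FpPow (F : Type*) {K : Type*} [Field F] [Field K] [Algebra F K] (p : ℕ) : Subgroup Kˣ :=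
  (Funits F).map (powMonoidHom p)

/-- The subgroup `N_{K_i/F}(K_i^×)` of `K^×`. -/
noncomputable def NormSub (p : ℕ) (σ : K ≃ₐ[F] K) (i : ℕ) : Subgroup Kˣ :=
  (KiU p σ i).map (normHom p σ i)

/-- The subgroup `N_{K_i/F}(K_i^×)·F^{×p}` of `K^×`. -/
noncomputable def NiF (p : ℕ) (σ : K ≃ₐ[F] K) (i : ℕ) : Subgroup Kˣ :=
  NormSub p σ i ⊔ FpPow F p

/-- The `F_p`-dimension of an (elementary abelian `p`-) commutative group `Q`,
computed as the rank of `F_p ⊗_ℤ Q`. -/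
noncomputable def fpdim (p : ℕ) (Q : Type*) [CommGroup Q] : Cardinal :=
  Module.rank (ZMod p) (TensorProduct ℤ (ZMod p) (Additive Q))

/-- The invariant `e_i(K/F)`: for `i < n` the `F_p`-dimension of
`N_{K_i/F}(K_i^×)F^{×p} / N_{K_{i+1}/F}(K_{i+1}^×)F^{×p}`, and for `i = n` the
`F_p`-dimension of `N_{K/F}(K^×)F^{×p}/F^{×p}`. -/
noncomputable def eKF (p n : ℕ) (σ : K ≃ₐ[F] K) (i : ℕ) : Cardinal :=
  if i < n then
    fpdim p ((NiF p σ i) ⧸ (NiF p σ (i + 1)).subgroupOf (NiF p σ i))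
  else
    fpdim p ((NiF p σ n) ⧸ (FpPow F p).subgroupOf (NiF p σ n))

/-- The group ring `R_m[G_i] = (ℤ/p^m)[ℤ/p^i]` (for the cyclic group `G_i` of order
`p^i`). -/
abbrev CycGR (p m i : ℕ) : Type :=
  MonoidAlgebra (ZMod (p ^ m)) (Multiplicative (ZMod (p ^ i)))

/-- The image of the generator `σ` of `G_i` in the group ring `R_m[G_i]`. -/
noncomputable def gen (p m i : ℕ) : CycGR p m i :=
  MonoidAlgebra.of _ _ (Multiplicative.ofAdd (1 : ZMod (p ^ i)))

/-- Standard basis vector of the free `R_m[G]`-module on generators `e_0, …, e_m`. -/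
noncomputable def sing (p n m : ℕ) (j : Fin (m + 1)) (c : CycGR p m n) :
    Fin (m + 1) → CycGR p m n :=
  Pi.single j c

/-- The relations defining the module `X_{a,d,m}`: on generators `y = e_0` and
`x_i = e_{i+1}` (`0 ≤ i < m`), we impose `(σ - d)·y = Σ_i p^i x_i`, and
`(σ^{p^{a_i}} - 1)·x_i = 0` when `a_i ≠ -∞`, resp. `x_i = 0` when `a_i = -∞`. -/
noncomputable def XRels (p n m : ℕ) (a : Fin m → WithBot ℕ) (d : ℤ) :
    Set (Fin (m + 1) → CycGR p m n) :=
  insert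
    (sing p n m 0 (gen p m n - (d : ZMod (p ^ m)) • 1) -
      ∑ i : Fin m, sing p n m i.succ ((p : CycGR p m n) ^ (i : ℕ)))
    {r | ∃ i : Fin m, r = sing p n m i.succ
      (WithBot.recBotCoe (1 : CycGR p m n) (fun k => gen p m n ^ p ^ k - 1) (a i))}

/-- The `R_m[G]`-module `X_{a,d,m}`. -/
noncomputable abbrev Xadm (p n m : ℕ) (a : Fin m → WithBot ℕ) (d : ℤ) :=
  (Fin (m + 1) → CycGR p m n) ⧸ Submodule.span (CycGR p m n) (XRels p n m a d)

/-- Indecomposability of a module. -/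
def IsIndecomposable (R M : Type*) [Ring R] [AddCommGroup M] [Module R M] : Prop :=
  (⊤ : Submodule R M) ≠ ⊥ ∧
  ∀ S T : Submodule R M, S ⊓ T = ⊥ → S ⊔ T = ⊤ → S = ⊥ ∨ T = ⊥

end MSS

namespace MSS

/-- The properties of an involution `σ` and an element `ε` of an abelian group that the
Galois action on `K^×` and the element `-1` have for a quadratic extension `K/F` in which
`-1` is not a norm. -/
structure IsQuadraticAction {A : Type*} [AddCommGroup A] (σ : A →+ A) (ε : A) : Prop where
  involutive : ∀ x, σ (σ x) = x
  exists_of_norm_eq_zero : ∀ x, x + σ x = 0 → ∃ z, σ z = x + z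
  eq_zero_or_eq : ∀ x, (2 : ℤ) • x = 0 → x = 0 ∨ x = ε
  two_smul_eps : (2 : ℤ) • ε = 0
  map_eps : σ ε = ε
  norm_ne_eps : ∀ x, x + σ x ≠ ε

/-- `f` induces a basis of the fixed points modulo norms and `ε`, and `v ↦ v + σ v` induces a
basis of the norms modulo doubles of fixed points. -/
structure IsNormFrame {A ι₀ ι : Type*} [AddCommGroup A] (σ : A →+ A) (ε : A)
    (f : ι₀ → A) (v : ι → A) : Prop where
  fixed : ∀ i, σ (f i) = f i
  span_fixed : ∀ x, σ x = x → ∃ (c : ι₀ →₀ ℤ) (d : ℤ) (y : A),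
    x = Finsupp.linearCombination ℤ f c + d • ε + (y + σ y)
  even_fixed : ∀ (c : ι₀ →₀ ℤ) (d : ℤ) (y : A),
    Finsupp.linearCombination ℤ f c + d • ε = y + σ y → ∀ i, 2 ∣ c i
  span_norm : ∀ y, ∃ (c : ι →₀ ℤ) (x : A), σ x = x ∧
    y + σ y = Finsupp.linearCombination ℤ v c + σ (Finsupp.linearCombination ℤ v c) + (2 : ℤ) • x
  even_norm : ∀ (c : ι →₀ ℤ) (x : A), σ x = x →
    Finsupp.linearCombination ℤ v c + σ (Finsupp.linearCombination ℤ v c) = (2 : ℤ) • x →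
      ∀ i, 2 ∣ c i

/-- The homomorphism `(c, x, y) ↦ ∑ cᵢ fᵢ + ∑ (xⱼ + yⱼ (σ - 1)) vⱼ`. -/
noncomputable def frameHom {A ι₀ ι : Type*} [AddCommGroup A] (σ : A →+ A)
    (f : ι₀ → A) (v : ι → A) : (ι₀ →₀ ℤ) × (ι →₀ ℤ) × (ι →₀ ℤ) →+ A where
  toFun p := Finsupp.linearCombination ℤ f p.1 + Finsupp.linearCombination ℤ v p.2.1 +
    (σ (Finsupp.linearCombination ℤ v p.2.2) - Finsupp.linearCombination ℤ v p.2.2)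
  map_zero' := by simp
  map_add' p q := by simp only [Prod.fst_add, Prod.snd_add, map_add]; abel

theorem exists_eq_two_smul {ι : Type*} (c : ι →₀ ℤ) (h : ∀ i, 2 ∣ c i) :
    ∃ c' : ι →₀ ℤ, c = (2 : ℤ) • c' := by
  refine ⟨c.mapRange (· / 2) (by simp), ?_⟩
  ext i
  have := h i
  simp only [Finsupp.smul_apply, Finsupp.mapRange_apply, smul_eq_mul]
  omega

section Frame

variable {A ι₀ ι : Type*} [AddCommGroup A] {σ : A →+ A} {ε : A} {f : ι₀ → A} {v : ι → A}

theorem frameHom_apply (c : ι₀ →₀ ℤ) (x y : ι →₀ ℤ) :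
    frameHom σ f v (c, x, y) = Finsupp.linearCombination ℤ f c +
      Finsupp.linearCombination ℤ v x +
      (σ (Finsupp.linearCombination ℤ v y) - Finsupp.linearCombination ℤ v y) := rfl

theorem IsNormFrame.map_linearCombination (hf : IsNormFrame σ ε f v) (c : ι₀ →₀ ℤ) :
    σ (Finsupp.linearCombination ℤ f c) = Finsupp.linearCombination ℤ f c := by
  simp only [Finsupp.linearCombination_apply, Finsupp.sum, map_sum, map_zsmul, hf.fixed]

theorem IsNormFrame.map_frameHom (hσ : IsQuadraticAction σ ε) (hf : IsNormFrame σ ε f v)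
    (c : ι₀ →₀ ℤ) (x y : ι →₀ ℤ) :
    σ (frameHom σ f v (c, x, y)) = frameHom σ f v (c, x, x - y) := by
  simp only [frameHom_apply, map_add, map_sub, hf.map_linearCombination, hσ.involutive]
  abel

/-- Coefficients of a combination that is a double are even. -/
theorem IsNormFrame.even_of_frameHom_eq (hσ : IsQuadraticAction σ ε) (hf : IsNormFrame σ ε f v)
    (c : ι₀ →₀ ℤ) (x y : ι →₀ ℤ) (k : A) (h : frameHom σ f v (c, x, y) = (2 : ℤ) • k) :
    (∀ i, 2 ∣ c i) ∧ (∀ j, 2 ∣ x j) ∧ ∀ j, 2 ∣ y j := by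
  rw [frameHom_apply] at h
  have hc := hf.map_linearCombination c
  set C := Finsupp.linearCombination ℤ f c with hC
  set Y := Finsupp.linearCombination ℤ v y with hY
  have hx : ∀ j, 2 ∣ x j := by
    refine hf.even_norm x (k + σ k - C) ?_ ?_
    · rw [map_sub, map_add, hσ.involutive, hc]; abel
    · have h' := congrArg σ h
      simp only [map_add, map_sub, map_zsmul, hσ.involutive, hc] at h'
      linear_combination (norm := module) h + h'
  obtain ⟨x', rfl⟩ := exists_eq_two_smul x hx
  rw [map_zsmul] at h
  set X := Finsupp.linearCombination ℤ v x' with hX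
  obtain ⟨k₁, hk₁⟩ : ∃ k₁, C + (Y + σ Y) = (2 : ℤ) • k₁ :=
    ⟨k - X + Y, by linear_combination (norm := module) h⟩
  have hk₁' : σ k₁ - k₁ = 0 ∨ σ k₁ - k₁ = ε := by
    refine hσ.eq_zero_or_eq _ ?_
    have h' := congrArg σ hk₁
    simp only [map_add, map_zsmul, hσ.involutive, hc] at h'
    linear_combination (norm := module) hk₁ - h'
  have hcev : ∀ i, 2 ∣ c i := by
    rcases hk₁' with h0 | h0
    · refine hf.even_fixed c 0 (k₁ - Y) ?_
      rw [← hC, map_sub]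
      linear_combination (norm := module) hk₁ - h0
    · refine hf.even_fixed c 1 (k₁ - Y) ?_
      rw [← hC, map_sub]
      linear_combination (norm := module) hk₁ - h0
  refine ⟨hcev, hx, ?_⟩
  obtain ⟨c', rfl⟩ := exists_eq_two_smul c hcev
  have hc' := hf.map_linearCombination c'
  rw [map_zsmul] at hC
  set C' := Finsupp.linearCombination ℤ f c'
  have h2 := hσ.two_smul_eps
  rcases hk₁' with h0 | h0
  · refine hf.even_norm y (k₁ - C') ?_ ?_
    · rw [map_sub, hc']; linear_combination (norm := module) h0
    · rw [← hY]; linear_combination (norm := module) hk₁ - hC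
  · refine absurd ?_ (hσ.norm_ne_eps (k₁ - C' - Y))
    simp only [map_sub, hc']
    linear_combination (norm := module) h0 - hk₁ + hC

theorem IsNormFrame.exists_frameHom_add_two_smul (hσ : IsQuadraticAction σ ε)
    (hf : IsNormFrame σ ε f v) (k : A) : ∃ p q, k = frameHom σ f v p + (2 : ℤ) • q := by
  have hw (w : A) : ∃ p q, w + σ w = frameHom σ f v p + (2 : ℤ) • q := by
    obtain ⟨y, h, -, hh⟩ := hf.span_norm w
    refine ⟨(0, 0, y), Finsupp.linearCombination ℤ v y + h, ?_⟩
    rw [frameHom_apply, map_zero, map_zero]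
    linear_combination (norm := module) hh
  have hε : ∃ s, (2 : ℤ) • s = ε + (s + σ s) := by
    obtain ⟨s, hs⟩ := hσ.exists_of_norm_eq_zero ε
      (by rw [hσ.map_eps, ← two_zsmul]; exact hσ.two_smul_eps)
    exact ⟨s, by linear_combination (norm := module) -hs - hσ.two_smul_eps⟩
  obtain ⟨x, g, hg, hx⟩ := hf.span_norm k
  obtain ⟨w, hw'⟩ := hσ.exists_of_norm_eq_zero (k - Finsupp.linearCombination ℤ v x - g) (by
    simp only [map_sub, hg]; linear_combination (norm := module) hx)
  obtain ⟨c, d, u, hu⟩ := hf.span_fixed g hg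
  obtain ⟨s, hs⟩ := hε
  obtain ⟨p, q, hpq⟩ := hw (w + u - d • s)
  refine ⟨p + (c, x, 0), q - w + d • s, ?_⟩
  have hs' := congrArg (d • ·) hs
  simp only [map_add, map_sub, map_zsmul, smul_add] at hpq hs'
  rw [map_add, frameHom_apply c x 0, map_zero, map_zero]
  simp only [smul_add, smul_sub]
  rw [smul_comm d (2 : ℤ)] at hs'
  linear_combination (norm := module) hpq + hu - hw' - hs'

theorem IsNormFrame.exists_frameHom_add_pow_smul (hσ : IsQuadraticAction σ ε)
    (hf : IsNormFrame σ ε f v) (m : ℕ) (k : A) :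
    ∃ p q, k = frameHom σ f v p + (2 ^ m : ℤ) • q := by
  induction m with
  | zero => exact ⟨0, k, by simp⟩
  | succ m ih =>
    obtain ⟨p, q, rfl⟩ := ih
    obtain ⟨p', q', rfl⟩ := hf.exists_frameHom_add_two_smul hσ q
    refine ⟨p + (2 ^ m : ℤ) • p', q', ?_⟩
    rw [map_add, map_zsmul, smul_add, smul_smul, pow_succ, add_assoc]

end Frame

section Frame

variable {A ι₀ ι : Type*} [AddCommGroup A] {σ : A →+ A} {ε : A} {f : ι₀ → A}

/-- If `ε` is infinitely `2`-divisible, the combinations in `2^m A` are those with coefficients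
divisible by `2^m`. -/
theorem IsNormFrame.frameHom_eq_pow_smul_iff {v : ι → A} (hσ : IsQuadraticAction σ ε)
    (hf : IsNormFrame σ ε f v) (hε : ∀ m : ℕ, ∃ x : A, (2 ^ m : ℤ) • x = ε) (m : ℕ)
    (c : ι₀ →₀ ℤ) (x y : ι →₀ ℤ) :
    (∃ k, frameHom σ f v (c, x, y) = (2 ^ m : ℤ) • k) ↔
      (∀ i, 2 ^ m ∣ c i) ∧ (∀ j, 2 ^ m ∣ x j) ∧ ∀ j, 2 ^ m ∣ y j := by
  induction m generalizing c x y with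
  | zero => simp
  | succ m ih =>
    constructor
    · rintro ⟨k, hk⟩
      obtain ⟨hc, hx, hy⟩ := hf.even_of_frameHom_eq hσ c x y ((2 ^ m : ℤ) • k)
        (by rw [hk, smul_smul, pow_succ'])
      obtain ⟨c, rfl⟩ := exists_eq_two_smul c hc
      obtain ⟨x, rfl⟩ := exists_eq_two_smul x hx
      obtain ⟨y, rfl⟩ := exists_eq_two_smul y hy
      rw [← Prod.smul_mk, ← Prod.smul_mk, map_zsmul] at hk
      have hk' : ∃ k, frameHom σ f v (c, x, y) = (2 ^ m : ℤ) • k := by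
        obtain ⟨e, he⟩ := hε m
        rcases hσ.eq_zero_or_eq (frameHom σ f v (c, x, y) - (2 ^ m : ℤ) • k)
          (by rw [smul_sub, hk, smul_smul, pow_succ', sub_self]) with h | h
        · exact ⟨k, sub_eq_zero.mp h⟩
        · exact ⟨k + e, by rw [smul_add, he, ← h]; abel⟩
      obtain ⟨h₁, h₂, h₃⟩ := (ih c x y).mp hk'
      simp only [Finsupp.smul_apply, smul_eq_mul, pow_succ']
      exact ⟨fun i => mul_dvd_mul_left _ (h₁ i), fun i => mul_dvd_mul_left _ (h₂ i),
        fun i => mul_dvd_mul_left _ (h₃ i)⟩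
    · rintro ⟨hc, hx, hy⟩
      have hd : (2 : ℤ) ∣ 2 ^ (m + 1) := dvd_pow_self _ (by omega)
      obtain ⟨c, rfl⟩ := exists_eq_two_smul c fun i => hd.trans (hc i)
      obtain ⟨x, rfl⟩ := exists_eq_two_smul x fun i => hd.trans (hx i)
      obtain ⟨y, rfl⟩ := exists_eq_two_smul y fun i => hd.trans (hy i)
      simp only [Finsupp.smul_apply, smul_eq_mul, pow_succ',
        mul_dvd_mul_iff_left (two_ne_zero (α := ℤ))] at hc hx hy
      obtain ⟨k, hk⟩ := (ih c x y).mpr ⟨hc, hx, hy⟩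
      exact ⟨k, by rw [← Prod.smul_mk, ← Prod.smul_mk, map_zsmul, hk, smul_smul, pow_succ']⟩

/-- If `ε` is `2^μ` times `(σ - 1) z` for the distinguished frame element `z`, the combinations
in `2^m A` are those with coefficients divisible by `2^m`, except that the coefficient of
`(σ - 1) z` only needs to be divisible by `2^(min m (μ + 1))`. -/
theorem IsNormFrame.frameHom_option_eq_pow_smul_iff {v : Option ι → A}
    (hσ : IsQuadraticAction σ ε) (hf : IsNormFrame σ ε f v) {μ : ℕ}
    (hv : (2 ^ μ : ℤ) • (σ (v none) - v none) = ε) (m : ℕ)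
    (c : ι₀ →₀ ℤ) (x y : Option ι →₀ ℤ) :
    (∃ k, frameHom σ f v (c, x, y) = (2 ^ m : ℤ) • k) ↔
      (∀ i, 2 ^ m ∣ c i) ∧ (∀ j, 2 ^ m ∣ x j) ∧ (∀ j, 2 ^ m ∣ y (some j)) ∧
        2 ^ min m (μ + 1) ∣ y none := by
  have hs (n : ℤ) : frameHom σ f v (0, 0, Finsupp.single none n) =
      n • (σ (v none) - v none) := by
    simp [frameHom_apply, smul_sub]
  induction m generalizing c x y with
  | zero => simp
  | succ m ih =>
    constructor
    · rintro ⟨k, hk⟩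
      obtain ⟨hc, hx, hy⟩ := hf.even_of_frameHom_eq hσ c x y ((2 ^ m : ℤ) • k)
        (by rw [hk, smul_smul, pow_succ'])
      obtain ⟨c, rfl⟩ := exists_eq_two_smul c hc
      obtain ⟨x, rfl⟩ := exists_eq_two_smul x hx
      obtain ⟨y, rfl⟩ := exists_eq_two_smul y hy
      rw [← Prod.smul_mk, ← Prod.smul_mk, map_zsmul] at hk
      obtain ⟨n, hn, k', hk'⟩ : ∃ n : ℤ, 2 ^ μ ∣ n ∧ ∃ k',
          frameHom σ f v (c, x, y - Finsupp.single none n) = (2 ^ m : ℤ) • k' := by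
        rcases hσ.eq_zero_or_eq (frameHom σ f v (c, x, y) - (2 ^ m : ℤ) • k)
          (by rw [smul_sub, hk, smul_smul, pow_succ', sub_self]) with h | h
        · exact ⟨0, dvd_zero _, k, by simpa using sub_eq_zero.mp h⟩
        · refine ⟨2 ^ μ, dvd_rfl, k, ?_⟩
          have : (c, x, y - Finsupp.single none (2 ^ μ)) =
            (c, x, y) - (0, 0, Finsupp.single none (2 ^ μ)) := by simp
          rw [this, map_sub, hs, hv, ← h]
          abel
      obtain ⟨h₁, h₂, h₃, h₄⟩ := (ih c x _).mp ⟨k', hk'⟩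
      simp only [Finsupp.coe_sub, Pi.sub_apply, Finsupp.single_apply, reduceCtorEq, if_false,
        sub_zero, if_true] at h₃ h₄
      have h₅ : (2 : ℤ) ^ min m μ ∣ y none := by
        have := ((pow_dvd_pow (2 : ℤ) (by omega : min m μ ≤ min m (μ + 1))).trans h₄).add
          ((pow_dvd_pow (2 : ℤ) (by omega : min m μ ≤ μ)).trans hn)
        rwa [sub_add_cancel] at this
      rw [Nat.add_min_add_right]
      simp only [Finsupp.smul_apply, smul_eq_mul, pow_succ']
      exact ⟨fun i => mul_dvd_mul_left _ (h₁ i), fun i => mul_dvd_mul_left _ (h₂ i),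
        fun i => mul_dvd_mul_left _ (h₃ i), mul_dvd_mul_left _ h₅⟩
    · rintro ⟨hc, hx, hy, hy'⟩
      have hd : (2 : ℤ) ∣ 2 ^ (m + 1) := dvd_pow_self _ (by omega)
      have hd' : (2 : ℤ) ∣ 2 ^ min (m + 1) (μ + 1) := dvd_pow_self _ (by omega)
      obtain ⟨c, rfl⟩ := exists_eq_two_smul c fun i => hd.trans (hc i)
      obtain ⟨x, rfl⟩ := exists_eq_two_smul x fun i => hd.trans (hx i)
      obtain ⟨y, rfl⟩ := exists_eq_two_smul y
        (Option.rec (hd'.trans hy') fun i => hd.trans (hy i))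
      rw [Nat.add_min_add_right] at hy'
      simp only [Finsupp.smul_apply, smul_eq_mul, pow_succ',
        mul_dvd_mul_iff_left (two_ne_zero (α := ℤ))] at hc hx hy hy'
      obtain ⟨n, hn, hy''⟩ : ∃ n : ℤ, 2 ^ μ ∣ n ∧ 2 ^ min m (μ + 1) ∣ y none - n := by
        rcases le_total m μ with h | h
        · exact ⟨0, dvd_zero _, by rwa [sub_zero, min_eq_left (by omega), ← min_eq_left h]⟩
        · exact ⟨y none, by rwa [min_eq_right h] at hy', by simp⟩
      obtain ⟨k, hk⟩ := (ih c x (y - Finsupp.single none n)).mpr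
        ⟨hc, hx, fun j => by simpa using hy j, by simpa using hy''⟩
      obtain ⟨n, rfl⟩ := hn
      refine ⟨k, ?_⟩
      have : ((2 : ℤ) • c, (2 : ℤ) • x, (2 : ℤ) • y) =
        (2 : ℤ) • (c, x, y - Finsupp.single none (2 ^ μ * n)) +
          (2 : ℤ) • (0, 0, Finsupp.single none (2 ^ μ * n)) := by
        simp [smul_sub]
      rw [this, map_add, map_zsmul, map_zsmul, hk, hs, mul_comm _ n, mul_smul n, hv,
        smul_comm (2 : ℤ) n, hσ.two_smul_eps, smul_zero, add_zero, smul_smul, pow_succ']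

end Frame

section GroupRing

variable {m : ℕ}

theorem gen_mul_gen : gen 2 m 1 * gen 2 m 1 = 1 := by
  rw [gen, ← map_mul, ← map_one (MonoidAlgebra.of _ _), ← ofAdd_add]
  rfl

theorem gen_eq_single :
    gen 2 m 1 = MonoidAlgebra.single (Multiplicative.ofAdd (1 : ZMod (2 ^ 1))) 1 := rfl

theorem gen_mul_combination (a b : ℤ) :
    gen 2 m 1 * (a + b * (gen 2 m 1 - 1)) =
      ((a : ℤ) : CycGR 2 m 1) + ((a - b : ℤ) : CycGR 2 m 1) * (gen 2 m 1 - 1) := by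
  push_cast
  linear_combination (b : CycGR 2 m 1) * gen_mul_gen (m := m)

theorem exists_eq_combination (r : CycGR 2 m 1) :
    ∃ a b : ℤ, r = a + b * (gen 2 m 1 - 1) := by
  induction r using MonoidAlgebra.induction_on with
  | of g =>
    have : g = 1 ∨ g = Multiplicative.ofAdd (1 : ZMod (2 ^ 1)) := by
      revert g; decide
    rcases this with rfl | rfl
    · exact ⟨1, 0, by simp [MonoidAlgebra.one_def]⟩
    · exact ⟨1, 1, by simp [gen]⟩
  | add x y hx hy =>
    obtain ⟨a, b, rfl⟩ := hx
    obtain ⟨c, d, rfl⟩ := hy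
    exact ⟨a + c, b + d, by push_cast; ring⟩
  | smul r x hx =>
    obtain ⟨a, b, rfl⟩ := hx
    obtain ⟨n, rfl⟩ := ZMod.intCast_surjective r
    refine ⟨n * a, n * b, ?_⟩
    rw [Int.cast_smul_eq_zsmul, zsmul_eq_mul]
    push_cast; ring

theorem combination_eq_zero_iff (a b : ℤ) :
    (a + b * (gen 2 m 1 - 1) : CycGR 2 m 1) = 0 ↔ (2 ^ m : ℤ) ∣ a ∧ (2 ^ m : ℤ) ∣ b := by
  have h0 (n : ℤ) : (n : ZMod (2 ^ m)) = 0 ↔ (2 ^ m : ℤ) ∣ n := by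
    rw [ZMod.intCast_zmod_eq_zero_iff_dvd]; push_cast; rfl
  have hz (n : ℤ) (h : (2 ^ m : ℤ) ∣ n) : (n : CycGR 2 m 1) = 0 := by
    rw [← map_intCast (algebraMap (ZMod (2 ^ m)) (CycGR 2 m 1)), (h0 n).mpr h, map_zero]
  constructor
  · intro h
    have h' : (MonoidAlgebra.single 1 ((a - b : ℤ) : ZMod (2 ^ m)) +
        MonoidAlgebra.single (Multiplicative.ofAdd (1 : ZMod (2 ^ 1))) (b : ZMod (2 ^ m)) :
        CycGR 2 m 1) = 0 := by
      rw [← h, gen_eq_single]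
      have (n : ℤ) : (n : CycGR 2 m 1) = MonoidAlgebra.single 1 (n : ZMod (2 ^ m)) := by
        rw [← map_intCast (algebraMap (ZMod (2 ^ m)) (CycGR 2 m 1))]; rfl
      rw [mul_sub, mul_one, this, this, MonoidAlgebra.single_mul_single, one_mul, mul_one,
        Int.cast_sub, MonoidAlgebra.single_sub]
      abel
    have hb := congrArg (fun r => r.coeff (Multiplicative.ofAdd (1 : ZMod (2 ^ 1)))) h'
    have ha := congrArg (fun r => r.coeff 1) h'
    have hne : (1 : Multiplicative (ZMod (2 ^ 1))) ≠ Multiplicative.ofAdd 1 := by decide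
    simp only [MonoidAlgebra.coeff_add, MonoidAlgebra.coeff_single, Finsupp.add_apply,
      Finsupp.single_apply, hne, hne.symm, if_true, if_false, add_zero, zero_add,
      MonoidAlgebra.coeff_zero, Finsupp.zero_apply, h0] at ha hb
    exact ⟨by simpa using ha.add hb, hb⟩
  · rintro ⟨ha, hb⟩
    rw [hz a ha, hz b hb, zero_mul, add_zero]

/-- The `R_m[G]`-module `R_m[G]/⟨2^k(σ-1)⟩`. -/
abbrev ExcMod (m k : ℕ) : Type :=
  CycGR 2 m 1 ⧸ Submodule.span (CycGR 2 m 1) {(2 : CycGR 2 m 1) ^ k * (gen 2 m 1 - 1)}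

theorem mk_combination_eq_zero_iff (k : ℕ) (a b : ℤ) :
    (Submodule.Quotient.mk (a + b * (gen 2 m 1 - 1) : CycGR 2 m 1) : ExcMod m k) = 0 ↔
      (2 ^ m : ℤ) ∣ a ∧ (2 ^ min m k : ℤ) ∣ b := by
  have key (c d : ℤ) : ((c + d * (gen 2 m 1 - 1)) * (2 ^ k * (gen 2 m 1 - 1)) : CycGR 2 m 1) =
      ((0 : ℤ) : CycGR 2 m 1) + ((2 ^ k * (c - 2 * d) : ℤ) : CycGR 2 m 1) * (gen 2 m 1 - 1) := by
    push_cast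
    linear_combination 2 ^ k * (d : CycGR 2 m 1) * gen_mul_gen (m := m)
  rw [Submodule.Quotient.mk_eq_zero, Submodule.mem_span_singleton]
  constructor
  · rintro ⟨r, hr⟩
    obtain ⟨c, d, rfl⟩ := exists_eq_combination r
    rw [smul_eq_mul, key] at hr
    have h := (combination_eq_zero_iff (m := m) (0 - a) (2 ^ k * (c - 2 * d) - b)).mp (by
      push_cast at hr ⊢; linear_combination hr)
    refine ⟨by simpa using h.1, ?_⟩
    have h₁ := (pow_dvd_pow (2 : ℤ) (min_le_left m k)).trans h.2
    have h₂ : (2 : ℤ) ^ min m k ∣ 2 ^ k * (c - 2 * d) :=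
      (pow_dvd_pow (2 : ℤ) (min_le_right m k)).mul_right _
    exact (dvd_sub_right h₂).mp h₁
  · rintro ⟨ha, hb⟩
    have hb' : ∃ n : ℤ, (2 : ℤ) ^ m ∣ b - 2 ^ k * n := by
      rcases le_total m k with h | h
      · exact ⟨0, by simpa [min_eq_left h] using hb⟩
      · rw [min_eq_right h] at hb
        obtain ⟨n, rfl⟩ := hb
        exact ⟨n, by simp⟩
    obtain ⟨n, hn⟩ := hb'
    have h := (combination_eq_zero_iff (m := m) a (b - 2 ^ k * n)).mpr ⟨ha, hn⟩
    refine ⟨n, ?_⟩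
    rw [smul_eq_mul]
    push_cast at h ⊢
    linear_combination -h

theorem isUnit_combination {a : ℤ} (ha : ¬ 2 ∣ a) (b : ℤ) :
    IsUnit (a + b * (gen 2 m 1 - 1) : CycGR 2 m 1) := by
  have hu : IsUnit ((a * (a - 2 * b) : ℤ) : ZMod (2 ^ m)) := by
    have : IsCoprime (a * (a - 2 * b)) (2 ^ m) := by
      have h2 : IsCoprime (2 : ℤ) (a * (a - 2 * b)) := by
        rw [Int.prime_two.irreducible.coprime_iff_not_dvd, Int.prime_two.dvd_mul]
        omega
      exact h2.symm.pow_right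
    exact (ZMod.coe_int_isUnit_iff_isCoprime _ _).mpr (by push_cast; exact this.symm)
  have hu' := hu.map (algebraMap (ZMod (2 ^ m)) (CycGR 2 m 1))
  rw [map_intCast] at hu'
  refine isUnit_of_mul_isUnit_left (y := ((a - 2 * b : ℤ) : CycGR 2 m 1) +
    ((-b : ℤ) : CycGR 2 m 1) * (gen 2 m 1 - 1)) ?_
  convert hu' using 1
  push_cast
  linear_combination -(b : CycGR 2 m 1) ^ 2 * gen_mul_gen (m := m)

theorem isIndecomposable_excMod (hm : 0 < m) (k : ℕ) :
    IsIndecomposable (CycGR 2 m 1) (ExcMod m k) := by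
  have htop (S : Submodule (CycGR 2 m 1) (ExcMod m k)) (r : CycGR 2 m 1) (hr : IsUnit r)
      (h : (Submodule.Quotient.mk r : ExcMod m k) ∈ S) : S = ⊤ := by
    obtain ⟨u, rfl⟩ := hr
    refine Submodule.eq_top_iff'.mpr fun x => ?_
    obtain ⟨x, rfl⟩ := Submodule.Quotient.mk_surjective _ x
    have := S.smul_mem (x * (u⁻¹ : (CycGR 2 m 1)ˣ)) h
    rwa [← Submodule.Quotient.mk_smul, smul_eq_mul, mul_assoc, Units.inv_mul, mul_one] at this
  constructor
  · intro h
    have h1 : (Submodule.Quotient.mk (((1 : ℤ) : CycGR 2 m 1) +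
        ((0 : ℤ) : CycGR 2 m 1) * (gen 2 m 1 - 1)) : ExcMod m k) = 0 := by
      rw [← Submodule.mem_bot (CycGR 2 m 1), ← h]; trivial
    have h2 := (dvd_pow_self (2 : ℤ) hm.ne').trans ((mk_combination_eq_zero_iff k 1 0).mp h1).1
    omega
  · intro S T hST hST'
    obtain ⟨s, hs, t, ht, hst⟩ := Submodule.mem_sup.mp
      (show (Submodule.Quotient.mk (1 : CycGR 2 m 1) : ExcMod m k) ∈ S ⊔ T by
        rw [hST']; trivial)
    obtain ⟨s, rfl⟩ := Submodule.Quotient.mk_surjective _ s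
    have ht' : t = Submodule.Quotient.mk (1 - s) := by
      rw [Submodule.Quotient.mk_sub, ← hst]; abel
    obtain ⟨a, b, rfl⟩ := exists_eq_combination s
    by_cases ha : 2 ∣ a
    · have : T = ⊤ := htop T _ (isUnit_combination (a := 1 - a) (by omega) (-b))
        (by rw [ht'] at ht; convert ht using 2; push_cast; ring)
      exact Or.inl (by rwa [this, inf_top_eq] at hST)
    · have : S = ⊤ := htop S _ (isUnit_combination ha b) hs
      exact Or.inr (by rwa [this, top_inf_eq] at hST)

end GroupRing

open Finsupp in
theorem _root_.AddMonoidHom.map_linearCombination_int {A B ι : Type*} [AddCommGroup A]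
    [AddCommGroup B] (φ : A →+ B) (g : ι → A) (c : ι →₀ ℤ) :
    φ (linearCombination ℤ g c) = linearCombination ℤ (φ ∘ g) c :=
  apply_linearCombination ℤ φ.toIntLinearMap g c

theorem exists_basis_option {k V : Type*} [Field k] [AddCommGroup V] [Module k V] (w : V)
    (hw : w ≠ 0) : ∃ (s : Set V) (b : Module.Basis (Option s) k V), b none = w := by
  classical
  have hs : LinearIndepOn k id {w} := by simpa using hw
  let w' : hs.extend (Set.subset_univ _) :=
    ⟨w, Module.Basis.subset_extend hs (Set.mem_singleton w)⟩
  let e : {x : hs.extend (Set.subset_univ _) // x ≠ w'} ≃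
      {x | ∃ h : x ∈ hs.extend (Set.subset_univ _), (⟨x, h⟩ : hs.extend _) ≠ w'} :=
    (Equiv.subtypeSubtypeEquivSubtypeExists _ _)
  exact ⟨_, (Module.Basis.extend hs).reindex
    ((Equiv.optionSubtypeNe w').symm.trans (Equiv.optionCongr e)), by
      rw [Module.Basis.reindex_apply, Module.Basis.extend_apply_self]; rfl⟩

/-- For a vector space over `F_p` the tensor product with `F_p` over `ℤ` is the space itself. -/
theorem rank_zmod_tensorProduct (p : ℕ) [Fact p.Prime] {V : Type*} [AddCommGroup V]
    [Module (ZMod p) V] :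
    Module.rank (ZMod p) (TensorProduct ℤ (ZMod p) V) = Module.rank (ZMod p) V := by
  let φ : V →ₗ[ZMod p] TensorProduct ℤ (ZMod p) V :=
    AddMonoidHom.toZModLinearMap p (TensorProduct.mk ℤ (ZMod p) V 1).toAddMonoidHom
  have hφ (x : V) : φ x = TensorProduct.tmul ℤ 1 x := rfl
  let ψ : TensorProduct ℤ (ZMod p) V →ₗ[ℤ] V :=
    TensorProduct.lift (LinearMap.mk₂ ℤ (fun (a : ZMod p) (x : V) => a • x)
      (fun _ _ _ => add_smul _ _ _) (fun _ _ _ => smul_assoc _ _ _)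
      (fun _ _ _ => smul_add _ _ _) (fun c a x => smul_comm a c x))
  have hψ (x : V) : ψ (φ x) = x := (TensorProduct.lift.tmul _ _).trans (one_smul _ x)
  refine (LinearEquiv.ofBijective φ ⟨Function.LeftInverse.injective hψ, fun y => ?_⟩).rank_eq.symm
  induction y using TensorProduct.induction_on with
  | zero => exact ⟨0, map_zero _⟩
  | tmul a x =>
    refine ⟨a • x, ?_⟩
    rw [map_smul, hφ, TensorProduct.smul_tmul', smul_eq_mul, mul_one]
  | add x y hx hy =>
    obtain ⟨x, rfl⟩ := hx
    obtain ⟨y, rfl⟩ := hy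
    exact ⟨x + y, map_add _ _ _⟩

/-- The family `g` in `B` induces an `F_2`-basis of `B/C`. -/
structure IsBasisMod {A ι : Type*} [AddCommGroup A] (B C : AddSubgroup A) (g : ι → A) : Prop where
  mem : ∀ i, g i ∈ B
  span : ∀ x ∈ B, ∃ c : ι →₀ ℤ, x - Finsupp.linearCombination ℤ g c ∈ C
  even : ∀ c : ι →₀ ℤ, Finsupp.linearCombination ℤ g c ∈ C → ∀ i, 2 ∣ c i

section Quotient

variable {X : Type*} [CommGroup X] {B C : Subgroup X}

theorem quotient_two_nsmul (h : ∀ x ∈ B, x ^ 2 ∈ C) (x : Additive (B ⧸ C.subgroupOf B)) :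
    2 • x = 0 := by
  obtain ⟨x, rfl⟩ := Additive.ofMul.surjective x
  obtain ⟨x, rfl⟩ := QuotientGroup.mk_surjective x
  rw [← ofMul_pow, ← QuotientGroup.mk_pow, ofMul_eq_zero, QuotientGroup.eq_one_iff]
  exact h x x.2

theorem isBasisMod_of_basis [Module (ZMod 2) (Additive (B ⧸ C.subgroupOf B))] {ι : Type*}
    (b : Module.Basis ι (ZMod 2) (Additive (B ⧸ C.subgroupOf B))) (g : ι → Additive B)
    (hg : ∀ i, (QuotientGroup.mk' (C.subgroupOf B)).toAdditive (g i) = b i) :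
    IsBasisMod (Subgroup.toAddSubgroup B) (Subgroup.toAddSubgroup C)
      (B.subtype.toAdditive ∘ g) := by
  set φ := (QuotientGroup.mk' (C.subgroupOf B)).toAdditive with hφ
  have hφ0 (x : Additive B) :
      φ x = 0 ↔ B.subtype.toAdditive x ∈ Subgroup.toAddSubgroup C := by
    exact QuotientGroup.eq_one_iff _
  have hb (c : ι →₀ ℤ) : φ (Finsupp.linearCombination ℤ g c) =
      Finsupp.linearCombination (ZMod 2) b (c.mapRange Int.cast Int.cast_zero) := by
    rw [AddMonoidHom.map_linearCombination_int, Finsupp.linearCombination_apply,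
      Finsupp.linearCombination_apply, Finsupp.sum_mapRange_index (by simp)]
    simp [hg, Int.cast_smul_eq_zsmul]
  refine ⟨fun i => (g i).toMul.2, fun x hx => ?_, fun c hc i => ?_⟩
  · let x' : Additive B := Additive.ofMul ⟨x.toMul, hx⟩
    have hx' : B.subtype.toAdditive x' = x := rfl
    refine ⟨(b.repr (φ x')).mapRange (fun a : ZMod 2 => (a.val : ℤ)) (by simp), ?_⟩
    rw [← AddMonoidHom.map_linearCombination_int, ← hx', ← map_sub, ← hφ0, map_sub, hb, sub_eq_zero]
    conv_lhs => rw [← b.linearCombination_repr (φ x')]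
    congr 1
    ext i
    simp
  · rw [← AddMonoidHom.map_linearCombination_int, ← hφ0, hb] at hc
    have := DFunLike.congr_fun ((linearIndependent_iff.mp b.linearIndependent) _ hc) i
    rw [Finsupp.mapRange_apply, Finsupp.zero_apply, ZMod.intCast_zmod_eq_zero_iff_dvd] at this
    exact_mod_cast this

variable (B C)

theorem exists_isBasisMod (h : ∀ x ∈ B, x ^ 2 ∈ C) :
    ∃ (s : Set (Additive (B ⧸ C.subgroupOf B))) (g : s → Additive X),
      Cardinal.mk s = fpdim 2 (B ⧸ C.subgroupOf B) ∧
      IsBasisMod (Subgroup.toAddSubgroup B) (Subgroup.toAddSubgroup C) g := by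
  let _ := AddCommGroup.zmodModule (quotient_two_nsmul h)
  let b := Module.Basis.ofVectorSpace (ZMod 2) (Additive (B ⧸ C.subgroupOf B))
  choose g hg using fun i => QuotientGroup.mk'_surjective (C.subgroupOf B) (b i).toMul
  exact ⟨_, _, by rw [fpdim, rank_zmod_tensorProduct, ← b.mk_eq_rank''],
    isBasisMod_of_basis b (fun i => Additive.ofMul (g i)) hg⟩

theorem exists_isBasisMod_option (h : ∀ x ∈ B, x ^ 2 ∈ C) (w : X) (hw : w ∈ B) (hw' : w ∉ C) :
    ∃ (s : Set (Additive (B ⧸ C.subgroupOf B))) (g : Option s → Additive X),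
      Cardinal.mk s + 1 = fpdim 2 (B ⧸ C.subgroupOf B) ∧ g none = Additive.ofMul w ∧
      IsBasisMod (Subgroup.toAddSubgroup B) (Subgroup.toAddSubgroup C) g := by
  let _ := AddCommGroup.zmodModule (quotient_two_nsmul h)
  obtain ⟨s, b, hb⟩ := exists_basis_option (k := ZMod 2)
    (Additive.ofMul (QuotientGroup.mk' (C.subgroupOf B) ⟨w, hw⟩)) (fun h0 => hw'
      ((QuotientGroup.eq_one_iff (N := C.subgroupOf B) (⟨w, hw⟩ : B)).mp h0))
  choose g hg using fun i => QuotientGroup.mk'_surjective (C.subgroupOf B) (b i).toMul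
  refine ⟨s, _, ?_, ?_, isBasisMod_of_basis b
    (fun i => Additive.ofMul (i.elim ⟨w, hw⟩ fun j => g (some j))) ?_⟩
  · rw [fpdim, rank_zmod_tensorProduct, ← b.mk_eq_rank'', Cardinal.mk_option]
  · rfl
  · rintro (_ | j)
    · exact hb.symm
    · exact hg (some j)

end Quotient

theorem IsNormFrame.of_isBasisMod {A ι₀ ι : Type*} [AddCommGroup A] {σ : A →+ A} {ε : A}
    {F N D : AddSubgroup A} (hF : ∀ x, x ∈ F ↔ σ x = x) (hN : ∀ x, x ∈ N ↔ ∃ y, y + σ y = x)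
    (hD : ∀ x, x ∈ D ↔ ∃ y, σ y = y ∧ x = (2 : ℤ) • y) {f : Option ι₀ → A} (hfε : f none = ε)
    (hf : IsBasisMod F N f) {v : ι → A} (hv : IsBasisMod N D (fun i => v i + σ (v i))) :
    IsNormFrame σ ε (f ∘ some) v := by
  have hlc (c : ι →₀ ℤ) : Finsupp.linearCombination ℤ (fun i => v i + σ (v i)) c =
      Finsupp.linearCombination ℤ v c + σ (Finsupp.linearCombination ℤ v c) :=
    (AddMonoidHom.map_linearCombination_int (AddMonoidHom.id A + σ) v c).symm
  refine ⟨fun i => (hF _).mp (hf.mem _), fun x hx => ?_, fun c d y h i => ?_, fun y => ?_,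
    fun c x hx h => hv.even c ?_⟩
  · obtain ⟨c, hc⟩ := hf.span x ((hF x).mpr hx)
    obtain ⟨y, hy⟩ := (hN _).mp hc
    refine ⟨c.some, c none, y, ?_⟩
    rw [hy, Finsupp.linearCombination_option, hfε]
    abel
  · have := hf.even (c.optionElim d) ((hN _).mpr ⟨y, ?_⟩) (some i)
    · rwa [Finsupp.optionElim_apply_some] at this
    · rw [← h, Finsupp.linearCombination_option, Finsupp.optionElim_apply_none,
        Finsupp.some_optionElim, hfε, add_comm]
  · obtain ⟨c, hc⟩ := hv.span (y + σ y) ((hN _).mpr ⟨y, rfl⟩)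
    obtain ⟨x, hx, h⟩ := (hD _).mp hc
    exact ⟨c, x, hx, by rw [← h, hlc]; abel⟩
  · rw [hlc]
    exact (hD _).mpr ⟨x, hx, h⟩

theorem exists_addEquiv_of_ker_eq {P B C : Type*} [AddCommGroup P] [AddCommGroup B]
    [AddCommGroup C] (g₁ : P →+ B) (g₂ : P →+ C) (h₁ : Function.Surjective g₁)
    (h₂ : Function.Surjective g₂) (h : g₁.ker = g₂.ker) :
    ∃ e : B ≃+ C, ∀ p, e (g₁ p) = g₂ p := by
  refine ⟨(QuotientAddGroup.quotientKerEquivOfSurjective g₁ h₁).symm.trans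
    ((QuotientAddGroup.quotientAddEquivOfEq h).trans
      (QuotientAddGroup.quotientKerEquivOfSurjective g₂ h₂)), fun p => ?_⟩
  have : (QuotientAddGroup.quotientKerEquivOfSurjective g₁ h₁).symm (g₁ p) =
      QuotientAddGroup.mk p := by
    rw [AddEquiv.symm_apply_eq]; rfl
  simp only [AddEquiv.trans_apply, this]
  rfl

/-- Reduction of integral coefficients modulo `2^m`. -/
noncomputable def redHom (m : ℕ) (ι : Type*) : (ι →₀ ℤ) →+ (ι →₀ ZMod (2 ^ m)) :=
  Finsupp.mapRange.addMonoidHom (Int.castAddHom _)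

/-- The homomorphism `(x, y) ↦ (xⱼ + yⱼ (σ - 1))ⱼ` to the free `R_m[G]`-module. -/
noncomputable def combHom (m : ℕ) (ι : Type*) :
    (ι →₀ ℤ) × (ι →₀ ℤ) →+ (ι →₀ CycGR 2 m 1) :=
  (Finsupp.mapRange.addMonoidHom (Int.castAddHom _)).coprod
    (Finsupp.mapRange.addMonoidHom
      ((AddMonoidHom.mulRight (gen 2 m 1 - 1)).comp (Int.castAddHom _)))

section

variable {m : ℕ} {ι : Type*}

theorem redHom_apply (c : ι →₀ ℤ) (i : ι) : redHom m ι c i = c i := rfl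

theorem combHom_apply (x y : ι →₀ ℤ) (j : ι) :
    combHom m ι (x, y) j = x j + y j * (gen 2 m 1 - 1) := rfl

theorem redHom_eq_zero_iff (c : ι →₀ ℤ) : redHom m ι c = 0 ↔ ∀ i, 2 ^ m ∣ c i := by
  simp only [Finsupp.ext_iff, redHom_apply, Finsupp.zero_apply,
    ZMod.intCast_zmod_eq_zero_iff_dvd, Nat.cast_pow, Nat.cast_ofNat]

theorem combHom_eq_zero_iff (x y : ι →₀ ℤ) :
    combHom m ι (x, y) = 0 ↔ (∀ j, 2 ^ m ∣ x j) ∧ ∀ j, 2 ^ m ∣ y j := by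
  simp only [Finsupp.ext_iff, combHom_apply, Finsupp.zero_apply, combination_eq_zero_iff,
    forall_and]

theorem redHom_surjective : Function.Surjective (redHom m ι) := by
  intro r
  induction r using Finsupp.induction_linear with
  | zero => exact ⟨0, map_zero _⟩
  | add x y hx hy =>
    obtain ⟨x, rfl⟩ := hx
    obtain ⟨y, rfl⟩ := hy
    exact ⟨x + y, map_add _ _ _⟩
  | single i a =>
    obtain ⟨n, rfl⟩ := ZMod.intCast_surjective a
    exact ⟨Finsupp.single i n, by simp [redHom]⟩

theorem combHom_surjective : Function.Surjective (combHom m ι) := by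
  intro r
  induction r using Finsupp.induction_linear with
  | zero => exact ⟨0, map_zero _⟩
  | add x y hx hy =>
    obtain ⟨x, rfl⟩ := hx
    obtain ⟨y, rfl⟩ := hy
    exact ⟨x + y, map_add _ _ _⟩
  | single i s =>
    obtain ⟨a, b, rfl⟩ := exists_eq_combination s
    exact ⟨(Finsupp.single i a, Finsupp.single i b), by simp [combHom]⟩

theorem combHom_gen (x y : ι →₀ ℤ) :
    combHom m ι (x, x - y) = gen 2 m 1 • combHom m ι (x, y) := by
  ext1 j
  rw [Finsupp.smul_apply, smul_eq_mul, combHom_apply, combHom_apply, gen_mul_combination]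
  simp

end

section

variable {A B ι₀ ι : Type*} [AddCommGroup A] [AddCommGroup B] {σ : A →+ A} {ε : A} {f : ι₀ → A}
  {m : ℕ} {q : A →+ B} {τ : B → B}

theorem IsNormFrame.frameHom_comp_surjective {v : ι → A} (hσ : IsQuadraticAction σ ε)
    (hf : IsNormFrame σ ε f v) (hq : Function.Surjective q)
    (hker : ∀ x, q x = 0 ↔ ∃ k, x = (2 ^ m : ℤ) • k) :
    Function.Surjective (q.comp (frameHom σ f v)) := by
  intro b
  obtain ⟨a, rfl⟩ := hq b
  obtain ⟨p, k, rfl⟩ := hf.exists_frameHom_add_pow_smul hσ m a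
  exact ⟨p, by rw [map_add, (hker _).mpr ⟨k, rfl⟩, add_zero, AddMonoidHom.comp_apply]⟩

theorem IsNormFrame.exists_addEquiv {v : ι → A} (hσ : IsQuadraticAction σ ε)
    (hf : IsNormFrame σ ε f v) (hε : ∀ m : ℕ, ∃ x : A, (2 ^ m : ℤ) • x = ε)
    (hq : Function.Surjective q) (hker : ∀ x, q x = 0 ↔ ∃ k, x = (2 ^ m : ℤ) • k)
    (hτ : ∀ x, τ (q x) = q (σ x)) :
    ∃ e : B ≃+ (ι₀ →₀ ZMod (2 ^ m)) × (ι →₀ CycGR 2 m 1),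
      ∀ x, e (τ x) = ((e x).1, gen 2 m 1 • (e x).2) := by
  have hs := hf.frameHom_comp_surjective hσ hq hker
  obtain ⟨e, he⟩ := exists_addEquiv_of_ker_eq (q.comp (frameHom σ f v))
    ((redHom m ι₀).prodMap (combHom m ι)) hs
    (Function.Surjective.prodMap redHom_surjective combHom_surjective) (by
      ext ⟨c, x, y⟩
      rw [AddMonoidHom.mem_ker, AddMonoidHom.mem_ker, AddMonoidHom.comp_apply, hker,
        hf.frameHom_eq_pow_smul_iff hσ hε]
      simp [redHom_eq_zero_iff, combHom_eq_zero_iff])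
  refine ⟨e, fun b => ?_⟩
  obtain ⟨⟨c, x, y⟩, rfl⟩ := hs b
  rw [he, AddMonoidHom.comp_apply, hτ, hf.map_frameHom hσ, ← AddMonoidHom.comp_apply, he]
  simp [combHom_gen]

/-- The homomorphism to the distinguished summand `R_m[G]/⟨2^k(σ-1)⟩`. -/
noncomputable def excHom (m k : ℕ) (ι : Type*) :
    (Option ι →₀ ℤ) × (Option ι →₀ ℤ) →+ ExcMod m k where
  toFun p := Submodule.Quotient.mk (p.1 none + p.2 none * (gen 2 m 1 - 1) : CycGR 2 m 1)
  map_zero' := by simp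
  map_add' p q := by
    rw [← Submodule.Quotient.mk_add]
    congr 1
    simp only [Prod.fst_add, Prod.snd_add, Finsupp.add_apply]
    push_cast
    ring

/-- Restriction of integral coefficients from `Option ι` to `ι`. -/
noncomputable def someHom (ι : Type*) : (Option ι →₀ ℤ) →+ (ι →₀ ℤ) where
  toFun := Finsupp.some
  map_zero' := Finsupp.some_zero
  map_add' := Finsupp.some_add

/-- The combination of `excHom`, `redHom` and `combHom`. -/
noncomputable def modelHom (m k : ℕ) (ι₀ ι : Type*) :
    (ι₀ →₀ ℤ) × (Option ι →₀ ℤ) × (Option ι →₀ ℤ) →+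
      ExcMod m k × (ι₀ →₀ ZMod (2 ^ m)) × (ι →₀ CycGR 2 m 1) :=
  ((excHom m k ι).comp (AddMonoidHom.snd _ _)).prod
    ((redHom m ι₀).prodMap ((combHom m ι).comp ((someHom ι).prodMap (someHom ι))))

theorem modelHom_apply (k : ℕ) (c : ι₀ →₀ ℤ) (x y : Option ι →₀ ℤ) :
    modelHom m k ι₀ ι (c, x, y) =
      (Submodule.Quotient.mk (x none + y none * (gen 2 m 1 - 1) : CycGR 2 m 1),
        redHom m ι₀ c, combHom m ι (x.some, y.some)) := rfl

theorem modelHom_surjective (k : ℕ) : Function.Surjective (modelHom m k ι₀ ι) := by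
  rintro ⟨z, r, s⟩
  obtain ⟨z, rfl⟩ := Submodule.Quotient.mk_surjective _ z
  obtain ⟨a, b, rfl⟩ := exists_eq_combination z
  obtain ⟨c, rfl⟩ := redHom_surjective r
  obtain ⟨⟨x, y⟩, rfl⟩ := combHom_surjective s
  refine ⟨(c, x.optionElim a, y.optionElim b), ?_⟩
  simp only [modelHom_apply, Finsupp.optionElim_apply_none, Finsupp.some_optionElim]

theorem modelHom_eq_zero_iff (k : ℕ) (c : ι₀ →₀ ℤ) (x y : Option ι →₀ ℤ) :
    modelHom m k ι₀ ι (c, x, y) = 0 ↔ (∀ i, 2 ^ m ∣ c i) ∧ (∀ j, 2 ^ m ∣ x j) ∧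
      (∀ j, 2 ^ m ∣ y (some j)) ∧ 2 ^ min m k ∣ y none := by
  rw [modelHom_apply, Prod.mk_eq_zero, Prod.mk_eq_zero, mk_combination_eq_zero_iff,
    redHom_eq_zero_iff, combHom_eq_zero_iff, Option.forall (p := fun j => 2 ^ m ∣ x j)]
  simp only [Finsupp.some_apply]
  tauto

theorem modelHom_gen (k : ℕ) (c : ι₀ →₀ ℤ) (x y : Option ι →₀ ℤ) :
    modelHom m k ι₀ ι (c, x, x - y) =
      (gen 2 m 1 • (modelHom m k ι₀ ι (c, x, y)).1, (modelHom m k ι₀ ι (c, x, y)).2.1,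
        gen 2 m 1 • (modelHom m k ι₀ ι (c, x, y)).2.2) := by
  have hsub : (x - y).some = x.some - y.some := map_sub (someHom ι) x y
  simp only [modelHom_apply, hsub, combHom_gen, ← Submodule.Quotient.mk_smul, smul_eq_mul,
    gen_mul_combination]
  rfl

theorem IsNormFrame.exists_addEquiv_option {v : Option ι → A} (hσ : IsQuadraticAction σ ε)
    (hf : IsNormFrame σ ε f v) {μ : ℕ} (hv : (2 ^ μ : ℤ) • (σ (v none) - v none) = ε)
    (hq : Function.Surjective q) (hker : ∀ x, q x = 0 ↔ ∃ k, x = (2 ^ m : ℤ) • k)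
    (hτ : ∀ x, τ (q x) = q (σ x)) :
    ∃ e : B ≃+ ExcMod m (μ + 1) × (ι₀ →₀ ZMod (2 ^ m)) × (ι →₀ CycGR 2 m 1),
      ∀ x, e (τ x) = (gen 2 m 1 • (e x).1, (e x).2.1, gen 2 m 1 • (e x).2.2) := by
  have hs := hf.frameHom_comp_surjective hσ hq hker
  obtain ⟨e, he⟩ := exists_addEquiv_of_ker_eq (q.comp (frameHom σ f v))
    (modelHom m (μ + 1) ι₀ ι) hs (modelHom_surjective _) (by
      ext ⟨c, x, y⟩
      rw [AddMonoidHom.mem_ker, AddMonoidHom.mem_ker, AddMonoidHom.comp_apply, hker,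
        hf.frameHom_option_eq_pow_smul_iff hσ hv, modelHom_eq_zero_iff])
  refine ⟨e, fun b => ?_⟩
  obtain ⟨⟨c, x, y⟩, rfl⟩ := hs b
  rw [he, AddMonoidHom.comp_apply, hτ, hf.map_frameHom hσ, ← AddMonoidHom.comp_apply, he,
    modelHom_gen]

end

section Field

variable {F : Type*} {K : Type*} [Field F] [Field K] [Algebra F K] {σ : K ≃ₐ[F] K}

theorem coe_umap (τ : K ≃ₐ[F] K) (x : Kˣ) : (umap τ x : K) = τ x := rfl

theorem normHom_zero (γ : Kˣ) : normHom 2 σ 0 γ = γ := by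
  ext; simp [normHom, coe_umap]

theorem normHom_one (γ : Kˣ) : normHom 2 σ 1 γ = γ * umap σ γ := by
  ext; simp [normHom, Finset.prod_range_succ, coe_umap]

theorem mem_KiU_zero (γ : Kˣ) : γ ∈ KiU 2 σ 0 ↔ umap σ γ = γ := by
  simp [KiU, MonoidHom.mem_ker, div_eq_one]

theorem mem_KiU_one (hσ : σ ^ 2 = 1) (γ : Kˣ) : γ ∈ KiU 2 σ 1 := by
  rw [KiU, MonoidHom.mem_ker, pow_one, hσ, MonoidHom.div_apply, div_eq_one]
  rfl

theorem umap_umap (hσ : σ ^ 2 = 1) (γ : Kˣ) : umap σ (umap σ γ) = γ := by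
  ext
  rw [coe_umap, coe_umap, ← AlgEquiv.mul_apply, ← sq, hσ]
  rfl

theorem isQuadraticAction (hσ : σ ^ 2 = 1) (hσ1 : σ ≠ 1)
    (hnorm : ¬ ∃ γ : Kˣ, normHom 2 σ 1 γ = -1) :
    IsQuadraticAction (umap σ).toAdditive (Additive.ofMul (-1 : Kˣ)) where
  involutive x := umap_umap hσ x.toMul
  exists_of_norm_eq_zero x hx := by
    obtain ⟨x, rfl⟩ := Additive.ofMul.surjective x
    have hx' : (x : K) * σ x = 1 := by
      have : x * umap σ x = 1 := hx
      simpa [coe_umap] using congrArg (Units.val) this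
    have hinv (w : K) : σ (σ w) = w := by
      rw [← AlgEquiv.mul_apply, ← sq, hσ]; rfl
    have hz (z : K) (h0 : z ≠ 0) (h : σ z = x * z) :
        ∃ z, (umap σ).toAdditive z = Additive.ofMul x + z :=
      ⟨Additive.ofMul (Units.mk0 z h0), congrArg Additive.ofMul (Units.ext h)⟩
    by_cases h1 : 1 + σ (x : K) = 0
    · have hxm : (x : K) = -1 := by
        have := congrArg σ h1
        rw [map_add, map_one, hinv, map_zero] at this
        linear_combination this
      obtain ⟨w, hw⟩ : ∃ w, σ w ≠ w := by
        by_contra! h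
        exact hσ1 (AlgEquiv.ext h)
      exact hz (w - σ w) (sub_ne_zero.mpr hw.symm) (by
        rw [map_sub, hinv, hxm]; ring)
    · exact hz (1 + σ x) h1 (by
        rw [map_add, map_one, hinv]; linear_combination -hx')
  eq_zero_or_eq x hx := by
    obtain ⟨x, rfl⟩ := Additive.ofMul.surjective x
    rw [two_zsmul] at hx
    have hx' : x * x = 1 := hx
    have : (x : K) * x = 1 := by simpa using congrArg Units.val hx'
    rcases mul_self_eq_one_iff.mp this with h | h
    · exact Or.inl (Units.ext h)
    · exact Or.inr (congrArg Additive.ofMul (Units.ext h))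
  two_smul_eps := by
    rw [two_zsmul, ← ofMul_mul, neg_mul_neg, one_mul, ofMul_one]
  map_eps := congrArg Additive.ofMul (Units.ext (by simp [coe_umap]))
  norm_ne_eps x hx := hnorm ⟨x.toMul, by rw [normHom_one]; exact hx⟩

theorem mem_FpPow_iff [IsGalois F K] [FiniteDimensional F K]
    (hgen : ∀ τ : K ≃ₐ[F] K, τ ∈ Subgroup.zpowers σ) (x : Kˣ) :
    x ∈ FpPow F 2 ↔ ∃ y, umap σ y = y ∧ x = y ^ 2 := by
  constructor
  · rintro ⟨_, ⟨a, rfl⟩, rfl⟩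
    exact ⟨Units.map (algebraMap F K : F →* K) a, Units.ext (σ.commutes (a : F)), rfl⟩
  · rintro ⟨y, hy, rfl⟩
    refine ⟨y, ?_, rfl⟩
    have hfix : ∀ τ : K ≃ₐ[F] K, τ (y : K) = y := by
      have hle : Subgroup.zpowers σ ≤ MulAction.stabilizer (K ≃ₐ[F] K) (y : K) := by
        rw [Subgroup.zpowers_le]
        exact congrArg Units.val hy
      exact fun τ => hle (hgen τ)
    obtain ⟨a, ha⟩ := IntermediateField.mem_bot.mp
      ((IsGalois.mem_bot_iff_fixed (F := F) _).mpr hfix)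
    have ha0 : a ≠ 0 := by
      rintro rfl
      exact y.ne_zero (by rw [← ha, map_zero])
    exact ⟨Units.mk0 a ha0, Units.ext ha⟩

/-- Roots of unity of `2`-power order have norm `1` if `-1` is not a norm. -/
theorem norm_eq_one_of_pow_eq_one (hnorm : ¬ ∃ γ : Kˣ, normHom 2 σ 1 γ = -1) (k : ℕ) (ζ : Kˣ)
    (hζ : ζ ^ 2 ^ k = 1) : normHom 2 σ 1 ζ = 1 := by
  induction k generalizing ζ with
  | zero => rw [pow_zero, pow_one] at hζ; rw [hζ, map_one]
  | succ k ih =>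
    have h := ih (ζ ^ 2) (by rw [← pow_mul, ← pow_succ', hζ])
    rw [map_pow] at h
    have h' : ((normHom 2 σ 1 ζ : Kˣ) : K) ^ 2 = 1 := by
      rw [← Units.val_pow_eq_pow_val, h, Units.val_one]
    rcases mul_self_eq_one_iff.mp ((sq _).symm.trans h') with h | h
    · exact Units.ext h
    · exact absurd ⟨ζ, Units.ext h⟩ hnorm

theorem mk_eq_zero_iff (m : ℕ) (x : Additive Kˣ) :
    (QuotientGroup.mk' (powSub K (2 ^ m))).toAdditive x = 0 ↔
      ∃ k, x = (2 ^ m : ℤ) • k := by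
  have h := QuotientGroup.eq_one_iff (N := powSub K (2 ^ m)) x.toMul
  have h2 (k : Additive Kˣ) : (2 ^ m : ℤ) • k = (2 ^ m : ℕ) • k := by
    rw [← natCast_zsmul]; push_cast; rfl
  simp only [h2]
  exact h.trans ⟨fun ⟨k, hk⟩ => ⟨k, hk.symm⟩, fun ⟨k, hk⟩ => ⟨k, hk.symm⟩⟩

theorem _root_.IsPrimitiveRoot.pow_two_pow_eq_neg_one {R : Type*} [CommRing R] [IsDomain R]
    {ζ : R} {k : ℕ} (hζ : IsPrimitiveRoot ζ (2 ^ (k + 1))) : ζ ^ 2 ^ k = -1 :=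
  (hζ.pow (by positivity) (pow_succ 2 k)).eq_neg_one_of_two_right

variable [IsGalois F K] [FiniteDimensional F K]

theorem mem_NiF_zero (hgen : ∀ τ : K ≃ₐ[F] K, τ ∈ Subgroup.zpowers σ) (x : Kˣ) :
    x ∈ NiF 2 σ 0 ↔ umap σ x = x := by
  constructor
  · have : NiF 2 σ 0 ≤ KiU 2 σ 0 := by
      refine sup_le ?_ fun x hx => ?_
      · rintro _ ⟨γ, hγ, rfl⟩
        rwa [normHom_zero]
      · obtain ⟨y, hy, rfl⟩ := (mem_FpPow_iff hgen x).mp hx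
        rw [mem_KiU_zero, map_pow, hy]
    exact fun hx => (mem_KiU_zero x).mp (this hx)
  · exact fun hx => Subgroup.mem_sup_left ⟨x, (mem_KiU_zero x).mpr hx, normHom_zero x⟩

theorem mem_NiF_one (hσ : σ ^ 2 = 1) (hgen : ∀ τ : K ≃ₐ[F] K, τ ∈ Subgroup.zpowers σ) (x : Kˣ) :
    x ∈ NiF 2 σ 1 ↔ ∃ y, y * umap σ y = x := by
  constructor
  · have : NiF 2 σ 1 ≤ (normHom 2 σ 1).range := by
      refine sup_le ?_ fun x hx => ?_
      · rintro _ ⟨γ, hγ, rfl⟩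
        exact ⟨γ, rfl⟩
      · obtain ⟨y, hy, rfl⟩ := (mem_FpPow_iff hgen x).mp hx
        exact ⟨y, by rw [normHom_one, hy, sq]⟩
    intro hx
    obtain ⟨y, rfl⟩ := this hx
    exact ⟨y, (normHom_one y).symm⟩
  · rintro ⟨y, rfl⟩
    exact Subgroup.mem_sup_left ⟨y, mem_KiU_one hσ y, normHom_one y⟩

theorem exists_frame_fixed (hσ : σ ^ 2 = 1) (hgen : ∀ τ : K ≃ₐ[F] K, τ ∈ Subgroup.zpowers σ)
    (hnorm : ¬ ∃ γ : Kˣ, normHom 2 σ 1 γ = -1) :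
    ∃ (s : Set (Additive (NiF 2 σ 0 ⧸ (NiF 2 σ 1).subgroupOf (NiF 2 σ 0))))
      (f : Option s → Additive Kˣ),
      Cardinal.mk s + 1 = eKF 2 1 σ 0 ∧ f none = Additive.ofMul (-1) ∧
      IsBasisMod (Subgroup.toAddSubgroup (NiF 2 σ 0)) (Subgroup.toAddSubgroup (NiF 2 σ 1)) f := by
  refine exists_isBasisMod_option _ _ (fun x hx => ?_) (-1) ?_ ?_
  · exact (mem_NiF_one hσ hgen _).mpr ⟨x, by rw [(mem_NiF_zero hgen _).mp hx, sq]⟩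
  · rw [mem_NiF_zero hgen]
    exact Units.ext (by simp [coe_umap])
  · rw [mem_NiF_one hσ hgen]
    simpa only [normHom_one] using hnorm

theorem sq_mem_FpPow (hσ : σ ^ 2 = 1) (hgen : ∀ τ : K ≃ₐ[F] K, τ ∈ Subgroup.zpowers σ)
    (x : Kˣ) (hx : x ∈ NiF 2 σ 1) : x ^ 2 ∈ FpPow F 2 := by
  obtain ⟨y, rfl⟩ := (mem_NiF_one hσ hgen x).mp hx
  exact (mem_FpPow_iff hgen _).mpr ⟨_, by rw [map_mul, umap_umap hσ, mul_comm], rfl⟩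

theorem exists_frame_norm (hσ : σ ^ 2 = 1) (hgen : ∀ τ : K ≃ₐ[F] K, τ ∈ Subgroup.zpowers σ) :
    ∃ (s : Set (Additive (NiF 2 σ 1 ⧸ (FpPow F 2).subgroupOf (NiF 2 σ 1))))
      (v : s → Additive Kˣ),
      Cardinal.mk s = eKF 2 1 σ 1 ∧
      IsBasisMod (Subgroup.toAddSubgroup (NiF 2 σ 1)) (Subgroup.toAddSubgroup (FpPow F 2))
        (fun i => v i + (umap σ).toAdditive (v i)) := by
  obtain ⟨s, g, hs, hg⟩ := exists_isBasisMod _ _ (sq_mem_FpPow hσ hgen)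
  choose v hv using fun i => (mem_NiF_one hσ hgen _).mp (hg.mem i)
  refine ⟨s, fun i => Additive.ofMul (v i), hs, ?_⟩
  convert hg with i
  exact hv i

theorem exists_frame_norm_option (hσ : σ ^ 2 = 1)
    (hgen : ∀ τ : K ≃ₐ[F] K, τ ∈ Subgroup.zpowers σ) (z : Kˣ)
    (hz : z * umap σ z ∉ FpPow F 2) :
    ∃ (s : Set (Additive (NiF 2 σ 1 ⧸ (FpPow F 2).subgroupOf (NiF 2 σ 1))))
      (v : Option s → Additive Kˣ),
      Cardinal.mk s + 1 = eKF 2 1 σ 1 ∧ v none = Additive.ofMul z ∧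
      IsBasisMod (Subgroup.toAddSubgroup (NiF 2 σ 1)) (Subgroup.toAddSubgroup (FpPow F 2))
        (fun i => v i + (umap σ).toAdditive (v i)) := by
  obtain ⟨s, g, hs, hgn, hg⟩ := exists_isBasisMod_option _ _ (sq_mem_FpPow hσ hgen)
    (z * umap σ z) ((mem_NiF_one hσ hgen _).mpr ⟨z, rfl⟩) hz
  choose v hv using fun i => (mem_NiF_one hσ hgen _).mp (hg.mem i)
  refine ⟨s, fun i => i.elim (Additive.ofMul z) fun j => Additive.ofMul (v (some j)), hs, rfl, ?_⟩
  convert hg with i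
  rcases i with _ | j
  · exact hgn.symm
  · exact hv (some j)

/-- The frame of `K^×` given by bases of `F^×/⟨N(K^×), -1⟩` and `N(K^×)/F^{×2}`. -/
theorem isNormFrame (hσ : σ ^ 2 = 1) (hgen : ∀ τ : K ≃ₐ[F] K, τ ∈ Subgroup.zpowers σ)
    {ι₀ ι : Type*} {f : Option ι₀ → Additive Kˣ} (hfε : f none = Additive.ofMul (-1))
    (hf : IsBasisMod (Subgroup.toAddSubgroup (NiF 2 σ 0)) (Subgroup.toAddSubgroup (NiF 2 σ 1)) f)
    {v : ι → Additive Kˣ}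
    (hv : IsBasisMod (Subgroup.toAddSubgroup (NiF 2 σ 1)) (Subgroup.toAddSubgroup (FpPow F 2))
        (fun i => v i + (umap σ).toAdditive (v i))) :
    IsNormFrame (umap σ).toAdditive (Additive.ofMul (-1)) (f ∘ some) v := by
  refine IsNormFrame.of_isBasisMod (fun x => mem_NiF_zero hgen x.toMul)
    (fun x => mem_NiF_one hσ hgen x.toMul) (fun x => ?_) hfε hf hv
  simp only [two_zsmul]
  have := mem_FpPow_iff hgen x.toMul
  simp only [sq] at this
  exact this

/-- If `ζ` is a root of unity of maximal `2`-power order in `K`, then `ζ = σ(z)/z` for some `z`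
whose norm is not a square in `F`. -/
theorem exists_exceptional (hσ : IsQuadraticAction (umap σ).toAdditive (Additive.ofMul (-1 : Kˣ)))
    (hgen : ∀ τ : K ≃ₐ[F] K, τ ∈ Subgroup.zpowers σ)
    (hnorm : ¬ ∃ γ : Kˣ, normHom 2 σ 1 γ = -1) {μ : ℕ} {ζ : K}
    (hζ : IsPrimitiveRoot ζ (2 ^ (μ + 1)))
    (hmax : ∀ w : K, ¬ IsPrimitiveRoot w (2 ^ (μ + 2))) :
    ∃ z : Kˣ, (umap σ z * z⁻¹) ^ 2 ^ μ = -1 ∧ z * umap σ z ∉ FpPow F 2 := by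
  let u : Kˣ := Units.mk0 ζ (hζ.ne_zero (by positivity))
  have hu : u ^ 2 ^ μ = -1 := Units.ext (by simpa [u] using hζ.pow_two_pow_eq_neg_one)
  have hu1 : u * umap σ u = 1 := by
    rw [← normHom_one]
    refine norm_eq_one_of_pow_eq_one hnorm (μ + 1) u ?_
    rw [pow_succ, pow_mul, hu, neg_one_sq]
  obtain ⟨z, hz⟩ := hσ.exists_of_norm_eq_zero (Additive.ofMul u) hu1
  have hz' : umap σ z.toMul = u * z.toMul := hz
  refine ⟨z.toMul, by rw [hz', mul_inv_cancel_right, hu], fun h => ?_⟩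
  obtain ⟨y, -, hy⟩ := (mem_FpPow_iff hgen _).mp h
  have hw : (y * z.toMul⁻¹) ^ 2 = u := by
    rw [mul_pow, ← hy, hz']
    simp [sq, mul_assoc, mul_left_comm]
  have hw1 : (y * z.toMul⁻¹) ^ 2 ^ (μ + 1) = -1 := by
    rw [pow_succ', pow_mul, hw, hu]
  have hne : (-1 : Kˣ) ≠ 1 := fun h => hnorm ⟨1, by rw [map_one, h]⟩
  refine hmax (y * z.toMul⁻¹ : Kˣ) (IsPrimitiveRoot.coe_units_iff.mpr ?_)
  refine IsPrimitiveRoot.iff_orderOf.mpr (orderOf_eq_prime_pow (by rwa [hw1]) ?_)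
  rw [pow_succ, pow_mul, hw1, neg_one_sq]

end Field

end MSS

universe u v

/-- **Theorem 2.**  Suppose `p = 2`, `char F ≠ 2`, `n = 1`, and
`-1 ∉ N_{K/F}(K^×)`.  Let `ν` be maximal with `ξ_{2^ν} ∈ K` (`ν = ∞` allowed).
Then for every `m ≥ 1`:  if `ν < ∞` then `J_m ≅ Z ⊕ Y₀ ⊕ Y₁` where
`Z ≅ R_m[G]/⟨2^ν(σ-1)⟩` is indecomposable, `Y₀` is a free `R_m`-module with
trivial `G`-action of rank `e(0) = e_0(K/F) - 1`, and `Y₁` is a free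
`R_m[G]`-module of rank `e(1) = e_1(K/F) - 1`; if `ν = ∞` then
`J_m ≅ Y₀ ⊕ Y₁` with ranks `e_0(K/F) - 1` and `e_1(K/F)`. -/
theorem statement_1 {F : Type u} {K : Type v} [Field F] [Field K] [Algebra F K]
    [IsGalois F K] [FiniteDimensional F K]
    (m : ℕ) (hm : 0 < m)
    (σ : K ≃ₐ[F] K) (horder : orderOf σ = 2 ^ 1)
    (hgen : ∀ τ : K ≃ₐ[F] K, τ ∈ Subgroup.zpowers σ)
    (hchar : ringChar F ≠ 2)
    (hnorm : ¬ ∃ γ : Kˣ, MSS.normHom 2 σ 1 γ = -1)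
    (ν : ℕ∞) (hν0 : 1 ≤ ν)
    (hν1 : ∀ k : ℕ, (k : ℕ∞) ≤ ν → ∃ ζ : K, IsPrimitiveRoot ζ (2 ^ k))
    (hν2 : ∀ k : ℕ, ν < (k : ℕ∞) → ∀ ζ : K, ¬ IsPrimitiveRoot ζ (2 ^ k)) :
    (∀ ν' : ℕ, ν = (ν' : ℕ∞) →
      ∃ ι₀ ι₁ : Type v,
        MSS.IsIndecomposable (MSS.CycGR 2 m 1)
          (MSS.CycGR 2 m 1 ⧸ Submodule.span (MSS.CycGR 2 m 1)
            {(2 : MSS.CycGR 2 m 1) ^ ν' * (MSS.gen 2 m 1 - 1)}) ∧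
        Cardinal.mk ι₀ + 1 = MSS.eKF 2 1 σ 0 ∧
        Cardinal.mk ι₁ + 1 = MSS.eKF 2 1 σ 1 ∧
        ∃ e : Additive (Kˣ ⧸ MSS.powSub K (2 ^ m)) ≃+
              ((MSS.CycGR 2 m 1 ⧸ Submodule.span (MSS.CycGR 2 m 1)
                  {(2 : MSS.CycGR 2 m 1) ^ ν' * (MSS.gen 2 m 1 - 1)}) ×
                (ι₀ →₀ ZMod (2 ^ m)) × (ι₁ →₀ MSS.CycGR 2 m 1)),
          ∀ x : Kˣ ⧸ MSS.powSub K (2 ^ m),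
            e (Additive.ofMul (MSS.jmap (2 ^ m) σ x)) =
              (MSS.gen 2 m 1 • (e (Additive.ofMul x)).1,
               (e (Additive.ofMul x)).2.1,
               MSS.gen 2 m 1 • (e (Additive.ofMul x)).2.2)) ∧
    (ν = ⊤ →
      ∃ ι₀ ι₁ : Type v,
        Cardinal.mk ι₀ + 1 = MSS.eKF 2 1 σ 0 ∧
        Cardinal.mk ι₁ = MSS.eKF 2 1 σ 1 ∧
        ∃ e : Additive (Kˣ ⧸ MSS.powSub K (2 ^ m)) ≃+
              ((ι₀ →₀ ZMod (2 ^ m)) × (ι₁ →₀ MSS.CycGR 2 m 1)),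
          ∀ x : Kˣ ⧸ MSS.powSub K (2 ^ m),
            e (Additive.ofMul (MSS.jmap (2 ^ m) σ x)) =
              ((e (Additive.ofMul x)).1,
               MSS.gen 2 m 1 • (e (Additive.ofMul x)).2)) := by
  have hσ2 : σ ^ 2 = 1 := by rw [← pow_one 2, ← horder]; exact pow_orderOf_eq_one σ
  have hσ1 : σ ≠ 1 := by rintro rfl; simp at horder
  have hσ := MSS.isQuadraticAction hσ2 hσ1 hnorm
  obtain ⟨s₀, f, hs₀, hfε, hf⟩ := MSS.exists_frame_fixed hσ2 hgen hnorm
  have hq : Function.Surjective (QuotientGroup.mk' (MSS.powSub K (2 ^ m))).toAdditive :=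
    fun x => QuotientGroup.mk'_surjective (MSS.powSub K (2 ^ m)) x
  constructor
  · rintro ν' rfl
    obtain ⟨μ, rfl⟩ : ∃ μ, ν' = μ + 1 :=
      Nat.exists_eq_add_one.mpr (by exact_mod_cast hν0)
    obtain ⟨ζ, hζ⟩ := hν1 (μ + 1) le_rfl
    obtain ⟨z, hz, hzN⟩ := MSS.exists_exceptional hσ hgen hnorm hζ
      (hν2 (μ + 2) (by exact_mod_cast Nat.lt_succ_self _))
    obtain ⟨s₁, v, hs₁, hvz, hv⟩ := MSS.exists_frame_norm_option hσ2 hgen z hzN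
    obtain ⟨e, he⟩ := (MSS.isNormFrame hσ2 hgen hfε hf hv).exists_addEquiv_option hσ (μ := μ)
      (by
        rw [hvz, show (2 ^ μ : ℤ) = ((2 ^ μ : ℕ) : ℤ) by push_cast; rfl, natCast_zsmul,
          sub_eq_add_neg]
        exact congrArg Additive.ofMul hz)
      hq (MSS.mk_eq_zero_iff m) (τ := (MSS.jmap (2 ^ m) σ).toAdditive) fun _ => rfl
    exact ⟨s₀, s₁, MSS.isIndecomposable_excMod hm _, hs₀, hs₁, e, fun x => he (Additive.ofMul x)⟩
  · rintro rfl
    obtain ⟨s₁, v, hs₁, hv⟩ := MSS.exists_frame_norm hσ2 hgen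
    obtain ⟨e, he⟩ := (MSS.isNormFrame hσ2 hgen hfε hf hv).exists_addEquiv hσ
      (fun k => by
        obtain ⟨ζ, hζ⟩ := hν1 (k + 1) le_top
        refine ⟨Additive.ofMul (Units.mk0 ζ (hζ.ne_zero (by positivity))), ?_⟩
        rw [show (2 ^ k : ℤ) = ((2 ^ k : ℕ) : ℤ) by push_cast; rfl, natCast_zsmul, ← ofMul_pow]
        exact congrArg Additive.ofMul (Units.ext (by simpa using hζ.pow_two_pow_eq_neg_one)))
      hq (MSS.mk_eq_zero_iff m) (τ := (MSS.jmap (2 ^ m) σ).toAdditive) fun _ => rfl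
    exact ⟨s₀, s₁, hs₀, hs₁, e, fun x => he (Additive.ofMul x)⟩
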